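/- Let Σ be a complete simplicial fan in N_ℝ, and for each maximal cone J with ray generators {v_j : j∈J} let u_{i,J} be the linear function equal to 1 at v_i and 0 at the other v_j, j∈J. For any continuous Σ-piecewise polynomial function f = (f_J), the rational function ∑_{|J|=rk N} (1/|Vol(J)|) f_J ∏_{i∈J} 1/u_{i,J} on N_ℂ is in fact a polynomial (it has no poles). -/

import Mathlib

open scoped BigOperators

/-- The simplicial cone spanned by the vectors `v i`, `i ∈ I`. -/
def coneOf {n r : ℕ} (v : Fin n → (Fin r → ℝ)) (I : Finset (Fin n)) : Set (Fin r → ℝ) :=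
  {x | ∃ a : Fin n → ℝ, (∀ i, 0 ≤ a i) ∧ (∀ i ∉ I, a i = 0) ∧ x = ∑ i, a i • v i}

/-! ### Geometry of the fan -/

/-- The functionals `ρ i`, `i ∈ J`, are the coordinates with respect to the vectors `v i`,
`i ∈ J`. -/
structure IsDualFamily {n r : ℕ} (v : Fin n → (Fin r → ℝ)) (J : Finset (Fin n))
    (ρ : Fin n → ((Fin r → ℝ) →ₗ[ℝ] ℝ)) : Prop where
  apply_eq : ∀ i ∈ J, ∀ j ∈ J, ρ i (v j) = if i = j then 1 else 0
  sum_smul : ∀ x, ∑ j ∈ J, ρ j x • v j = x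

theorem exists_isDualFamily {n r : ℕ} {v : Fin n → (Fin r → ℝ)} {J : Finset (Fin n)}
    (hind : LinearIndependent ℝ (fun i : J => v i)) (hcard : J.card = r) :
    ∃ ρ, IsDualFamily v J ρ := by
  classical
  have hc : Fintype.card J = Module.finrank ℝ (Fin r → ℝ) := by simp [hcard]
  let b := basisOfLinearIndependentOfCardEqFinrank' (fun i : J => v i) hind hc
  have hb : ∀ i : J, b i = v i := fun i => by simp [b]
  refine ⟨fun i => if h : i ∈ J then b.coord ⟨i, h⟩ else 0, ?_, ?_⟩
  · intro i hi j hj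
    have := hb ⟨j, hj⟩
    simp only at this
    simp only [hi, dif_pos, ← this, Module.Basis.coord_apply, Module.Basis.repr_self,
      Finsupp.single_apply, Subtype.mk.injEq]
    simp only [eq_comm]
  · intro x
    rw [← Finset.sum_coe_sort]
    conv_rhs => rw [← b.sum_repr x]
    refine Finset.sum_congr rfl fun j _ => ?_
    simp [hb]

theorem coneOf_mono {n r : ℕ} (v : Fin n → (Fin r → ℝ)) {I J : Finset (Fin n)} (h : I ⊆ J) :
    coneOf v I ⊆ coneOf v J := by
  rintro x ⟨a, ha, ha', rfl⟩
  exact ⟨a, ha, fun i hi => ha' i fun hI => hi (h hI), rfl⟩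

theorem sum_smul_mem_coneOf {n r : ℕ} (v : Fin n → (Fin r → ℝ)) {I : Finset (Fin n)}
    {a : Fin n → ℝ} (ha : ∀ i ∈ I, 0 ≤ a i) : ∑ i ∈ I, a i • v i ∈ coneOf v I := by
  classical
  refine ⟨fun i => if i ∈ I then a i else 0, fun i => ?_, fun i hi => by simp [hi], ?_⟩
  · dsimp only
    split_ifs with h
    exacts [ha i h, le_rfl]
  · simp [ite_smul, Finset.sum_ite_mem]

namespace IsDualFamily

variable {n r : ℕ} {v : Fin n → (Fin r → ℝ)} {J : Finset (Fin n)}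
  {ρ : Fin n → ((Fin r → ℝ) →ₗ[ℝ] ℝ)}

theorem apply_sum (h : IsDualFamily v J ρ) {i : Fin n} (hi : i ∈ J) {I : Finset (Fin n)}
    (hI : I ⊆ J) (a : Fin n → ℝ) :
    ρ i (∑ j ∈ I, a j • v j) = if i ∈ I then a i else 0 := by
  classical
  rw [map_sum, ← Finset.sum_ite_eq I i a]
  refine Finset.sum_congr rfl fun j hj => ?_
  rw [map_smul, h.apply_eq i hi j (hI hj)]
  simp

theorem mem_coneOf_iff (h : IsDualFamily v J ρ) {x : Fin r → ℝ} :
    x ∈ coneOf v J ↔ ∀ i ∈ J, 0 ≤ ρ i x := by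
  constructor
  · rintro ⟨a, ha, ha', rfl⟩ i hi
    rw [← Finset.sum_subset (Finset.subset_univ J) fun j _ hj => by simp [ha' j hj],
      h.apply_sum hi subset_rfl, if_pos hi]
    exact ha i
  · intro hx
    rw [← h.sum_smul x]
    exact sum_smul_mem_coneOf v hx

/-- A point of the cone over `J` that lies in a face `I` has vanishing coordinates
outside of `I`. -/
theorem mem_of_apply_ne_zero (h : IsDualFamily v J ρ) {I : Finset (Fin n)} (hI : I ⊆ J)
    {x : Fin r → ℝ} (hx : x ∈ coneOf v I) {i : Fin n} (hi : i ∈ J) (hne : ρ i x ≠ 0) : i ∈ I := by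
  obtain ⟨a, ha, ha', rfl⟩ := hx
  rw [← Finset.sum_subset (Finset.subset_univ I) fun j _ hj => by simp [ha' j hj],
    h.apply_sum hi hI] at hne
  by_contra hiI
  simp [hiI] at hne

end IsDualFamily

section Fan

variable {n r : ℕ} {v : Fin n → (Fin r → ℝ)} {S : Finset (Finset (Fin n))}

/-- A facet of a maximal cone is contained in another maximal cone, on the opposite side. -/
theorem exists_adjacent
    (hglue : ∀ I ∈ S, ∀ J ∈ S, coneOf v I ∩ coneOf v J = coneOf v (I ∩ J))
    (hcomplete : (⋃ I ∈ S, coneOf v I) = Set.univ)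
    (hmax : ∀ I ∈ S, ∃ J ∈ S, I ⊆ J ∧ J.card = r)
    {ρ : Finset (Fin n) → Fin n → ((Fin r → ℝ) →ₗ[ℝ] ℝ)}
    (hρ : ∀ J ∈ S, J.card = r → IsDualFamily v J (ρ J))
    {J : Finset (Fin n)} (hJ : J ∈ S) (hJr : J.card = r) {i : Fin n} (hi : i ∈ J) :
    ∃ K ∈ S, K.card = r ∧ ∃ k, k ∉ J.erase i ∧ insert k (J.erase i) = K ∧ ρ J i (v k) < 0 := by
  classical
  have hdJ := hρ J hJ hJr
  set p : Fin r → ℝ := ∑ j ∈ J.erase i, (1 : ℝ) • v j with hp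
  have hpJ : ∀ j ∈ J, ρ J j p = if j ∈ J.erase i then 1 else 0 := fun j hj =>
    hdJ.apply_sum hj (Finset.erase_subset _ _) (fun _ => 1)
  have hex : ∀ m : ℕ, ∃ K ∈ S, K.card = r ∧ p - (1 / ((m : ℝ) + 1)) • v i ∈ coneOf v K := by
    intro m
    have : p - (1 / ((m : ℝ) + 1)) • v i ∈ ⋃ I ∈ S, coneOf v I := hcomplete ▸ Set.mem_univ _
    simp only [Set.mem_iUnion] at this
    obtain ⟨I, hI, hx⟩ := this
    obtain ⟨K, hK, hIK, hKr⟩ := hmax I hI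
    exact ⟨K, hK, hKr, coneOf_mono v hIK hx⟩
  choose κ hκS hκr hκ using hex
  obtain ⟨K, hKinf⟩ := Finite.exists_infinite_fiber κ
  have hKinf' : (κ ⁻¹' {K}).Infinite := Set.infinite_coe_iff.mp hKinf
  obtain ⟨m₀, hm₀⟩ := hKinf'.nonempty
  have hKS : K ∈ S := hm₀ ▸ hκS m₀
  have hKr : K.card = r := hm₀ ▸ hκr m₀
  have hdK := hρ K hKS hKr
  have hfreq : ∃ᶠ m in Filter.atTop, κ m = K := Nat.frequently_atTop_iff_infinite.mpr hKinf'
  have hpK : p ∈ coneOf v K := by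
    rw [hdK.mem_coneOf_iff]
    intro j hj
    have hlim : Filter.Tendsto (fun m : ℕ => ρ K j p - (1 / ((m : ℝ) + 1)) * ρ K j (v i))
        Filter.atTop (nhds (ρ K j p - 0 * ρ K j (v i))) :=
      tendsto_const_nhds.sub (tendsto_one_div_add_atTop_nhds_zero_nat.mul_const _)
    rw [zero_mul, sub_zero] at hlim
    refine isClosed_Ici.mem_of_frequently_of_tendsto (s := Set.Ici (0 : ℝ))
      (hfreq.mono fun m hm => ?_) hlim
    have := hdK.mem_coneOf_iff.mp (hm ▸ hκ m) j hj
    simpa using this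
  have hpJ' : p ∈ coneOf v J := by
    rw [hdJ.mem_coneOf_iff]
    intro j hj
    rw [hpJ j hj]
    split_ifs <;> norm_num
  have hpJK : p ∈ coneOf v (J ∩ K) := hglue J hJ K hKS ▸ ⟨hpJ', hpK⟩
  have hsub : J.erase i ⊆ K := by
    intro j hj
    have hjJ := Finset.mem_of_mem_erase hj
    refine (Finset.mem_inter.mp (hdJ.mem_of_apply_ne_zero Finset.inter_subset_left hpJK hjJ ?_)).2
    rw [hpJ j hjJ, if_pos hj]
    exact one_ne_zero
  obtain ⟨k, hk, hkK⟩ := Finset.exists_eq_insert_iff.mpr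
    ⟨hsub, by rw [Finset.card_erase_add_one hi, hJr, hKr]⟩
  refine ⟨K, hKS, hKr, k, hk, hkK, ?_⟩
  have hkmem : k ∈ K := hkK ▸ Finset.mem_insert_self _ _
  set x : Fin r → ℝ := p - (1 / ((m₀ : ℝ) + 1)) • v i with hx
  have hxK : 0 ≤ ρ K k x := hdK.mem_coneOf_iff.mp (hm₀ ▸ hκ m₀) k hkmem
  have h1 : ρ J i x = - (1 / ((m₀ : ℝ) + 1)) := by
    rw [hx, map_sub, map_smul, hpJ i hi, hdJ.apply_eq i hi i hi]
    simp
  have h2 : ρ J i x = ρ K k x * ρ J i (v k) := by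
    conv_lhs => rw [← hdK.sum_smul x, ← hkK, Finset.sum_insert hk]
    rw [map_add, hdJ.apply_sum hi (Finset.erase_subset _ _)]
    simp [hkK]
  have h3 : ρ K k x * ρ J i (v k) < 0 := by
    rw [← h2, h1, neg_lt_zero]
    positivity
  by_contra hcon
  exact absurd h3 (not_lt.mpr (mul_nonneg hxK (not_lt.mp hcon)))

/-- Two maximal cones on the same side of a common facet coincide. -/
theorem eq_of_pos_apply
    (hglue : ∀ I ∈ S, ∀ J ∈ S, coneOf v I ∩ coneOf v J = coneOf v (I ∩ J))
    {ρ : Finset (Fin n) → Fin n → ((Fin r → ℝ) →ₗ[ℝ] ℝ)}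
    (hρ : ∀ J ∈ S, J.card = r → IsDualFamily v J (ρ J))
    {J K W : Finset (Fin n)} (hJ : J ∈ S) (hJr : J.card = r) (hK : K ∈ S) (hKr : K.card = r)
    {i k : Fin n} (hi : i ∉ W) (hiJ : insert i W = J) (hkK : insert k W = K)
    (hpos : 0 < ρ J i (v k)) : J = K := by
  classical
  have hdJ := hρ J hJ hJr
  have hdK := hρ K hK hKr
  have hWJ : W ⊆ J := hiJ ▸ Finset.subset_insert _ _
  have hWK : W ⊆ K := hkK ▸ Finset.subset_insert _ _
  have hiJ' : i ∈ J := hiJ ▸ Finset.mem_insert_self _ _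
  have hk : k ∉ W := by
    intro hk
    rw [hdJ.apply_eq i hiJ' k (hWJ hk), if_neg (by rintro rfl; exact hi hk)] at hpos
    exact lt_irrefl _ hpos
  have hkK' : k ∈ K := hkK ▸ Finset.mem_insert_self _ _
  obtain ⟨M, hM⟩ : ∃ M : ℝ, ∀ j ∈ W, -ρ J j (v k) ≤ M := by
    obtain ⟨M, hM⟩ := (W.image fun j => -ρ J j (v k)).bddAbove
    exact ⟨M, fun j hj => hM (by simpa using ⟨j, hj, rfl⟩)⟩
  set c : ℝ := max M 1
  have hc : 0 < c := lt_max_of_lt_right one_pos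
  set x : Fin r → ℝ := ∑ j ∈ K, (if j = k then 1 else c) • v j with hx
  have hxK : ∀ j ∈ K, ρ K j x = if j = k then 1 else c := by
    intro j hj
    rw [hx, hdK.apply_sum hj subset_rfl, if_pos hj]
  have hxK0 : ∀ j ∈ K, 0 < ρ K j x := by
    intro j hj
    rw [hxK j hj]
    split_ifs
    exacts [one_pos, hc]
  have hx' : x = v k + ∑ j ∈ W, c • v j := by
    rw [hx, ← hkK, Finset.sum_insert hk, if_pos rfl, one_smul]
    congr 1
    refine Finset.sum_congr rfl fun j hj => ?_
    rw [if_neg (by rintro rfl; exact hk hj)]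
  have hxJ : x ∈ coneOf v J := by
    rw [hdJ.mem_coneOf_iff]
    intro j hj
    rw [hx', map_add, hdJ.apply_sum hj hWJ (fun _ => c)]
    split_ifs with hjW
    · linarith [hM j hjW, le_max_left M 1]
    · have : j = i := by
        rw [← hiJ, Finset.mem_insert] at hj
        exact hj.resolve_right hjW
      subst this
      linarith
  have hxJK : x ∈ coneOf v (J ∩ K) :=
    hglue J hJ K hK ▸ ⟨hxJ, hdK.mem_coneOf_iff.mpr fun j hj => (hxK0 j hj).le⟩
  have hsub : K ⊆ J := fun j hj => (Finset.mem_inter.mp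
    (hdK.mem_of_apply_ne_zero Finset.inter_subset_right hxJK hj (hxK0 j hj).ne')).1
  exact (Finset.eq_of_subset_of_card_le hsub (by rw [hJr, hKr])).symm

end Fan

/-! ### Fractions without poles -/

section Fractions

variable {R K : Type*} [CommRing R] [Field K] [Algebra R K]

/-- The additive monoid of fractions that have no pole along `p`. -/
def regularAt (K : Type*) [Field K] [Algebra R K] {p : R} (hp : Prime p) : AddSubmonoid K where
  carrier := {s | ∃ a b : R, ¬ p ∣ b ∧ s * algebraMap R K b = algebraMap R K a}
  zero_mem' := ⟨0, 1, hp.not_dvd_one, by simp⟩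
  add_mem' := by
    rintro s t ⟨a, b, hb, hs⟩ ⟨c, d, hd, ht⟩
    refine ⟨a * d + c * b, b * d, hp.not_dvd_mul hb hd, ?_⟩
    simp only [map_add, map_mul, ← hs, ← ht]
    ring

theorem div_mem_regularAt [IsDomain R] [IsFractionRing R K] {p : R} (hp : Prime p) (a : R) {b : R}
    (hb : ¬ p ∣ b) : algebraMap R K a / algebraMap R K b ∈ regularAt K hp := by
  refine ⟨a, b, hb, div_mul_cancel₀ _ ?_⟩
  rw [Ne, IsFractionRing.to_map_eq_zero_iff]
  rintro rfl
  exact hb (dvd_zero p)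

theorem exists_algebraMap_eq_of_forall_mem_regularAt [IsDomain R] [UniqueFactorizationMonoid R]
    [IsFractionRing R K] {s : K} (h : ∀ p : R, ∀ hp : Prime p, s ∈ regularAt K hp) :
    ∃ a, algebraMap R K a = s := by
  suffices hu : IsUnit (IsFractionRing.den R s : R) from
    IsFractionRing.isInteger_of_isUnit_den hu
  by_contra hu
  obtain ⟨p, hp, hpd⟩ := WfDvdMonoid.exists_irreducible_factor hu
    (nonZeroDivisors.coe_ne_zero (IsFractionRing.den R s))
  obtain ⟨a, b, hb, hs⟩ := h p hp.prime
  have hnum : IsFractionRing.num R s * b = a * IsFractionRing.den R s := by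
    apply IsFractionRing.injective R K
    rw [map_mul, map_mul, ← hs, ← IsFractionRing.num_mul_den_eq_num_iff_eq.mpr rfl]
    ring
  rcases hp.prime.dvd_or_dvd (hnum ▸ dvd_mul_of_dvd_right hpd a) with h1 | h1
  · exact hp.not_isUnit (IsFractionRing.num_den_reduced R s h1 hpd)
  · exact hb h1

/-- A sum of fractions can be evaluated wherever no denominator vanishes. -/
theorem sum_div_eq_of_sum_div_eq_algebraMap {F ι : Type*} [Field F] [IsDomain R]
    [IsFractionRing R K] (φ : R →+* F) (s : Finset ι) (a b : ι → R) (P : R)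
    (hb : ∀ j ∈ s, φ (b j) ≠ 0)
    (h : ∑ j ∈ s, algebraMap R K (a j) / algebraMap R K (b j) = algebraMap R K P) :
    ∑ j ∈ s, φ (a j) / φ (b j) = φ P := by
  classical
  have key : ∃ N D : R, φ D ≠ 0 ∧
      ∑ j ∈ s, algebraMap R K (a j) / algebraMap R K (b j) = algebraMap R K N / algebraMap R K D ∧
      ∑ j ∈ s, φ (a j) / φ (b j) = φ N / φ D := by
    clear h
    induction s using Finset.induction_on with
    | empty => exact ⟨0, 1, by simp, by simp, by simp⟩
    | insert j s hj ih =>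
      obtain ⟨N, D, hD, h1, h2⟩ := ih fun i hi => hb i (Finset.mem_insert_of_mem hi)
      have hbj := hb j (Finset.mem_insert_self _ _)
      have hne : ∀ c : R, φ c ≠ 0 → algebraMap R K c ≠ 0 := by
        intro c hc h0
        rw [IsFractionRing.to_map_eq_zero_iff] at h0
        exact hc (by rw [h0, map_zero])
      refine ⟨a j * D + b j * N, b j * D, by simp [hbj, hD], ?_, ?_⟩
      · rw [Finset.sum_insert hj, h1, div_add_div _ _ (hne _ hbj) (hne _ hD)]
        simp only [map_add, map_mul]
      · rw [Finset.sum_insert hj, h2, div_add_div _ _ hbj hD]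
        simp only [map_add, map_mul]
  obtain ⟨N, D, hD, h1, h2⟩ := key
  have hD' : algebraMap R K D ≠ 0 := by
    intro h0
    rw [IsFractionRing.to_map_eq_zero_iff] at h0
    exact hD (by rw [h0, map_zero])
  have hPD : P * D = N := by
    apply IsFractionRing.injective R K
    rw [map_mul, ← h, h1, div_mul_cancel₀ _ hD']
  rw [h2, ← hPD, map_mul, mul_div_cancel_right₀ _ hD]

theorem prod_sub_prod_dvd {ι : Type*} (l : R) (s : Finset ι) (a b : ι → R)
    (h : ∀ j ∈ s, l ∣ a j - b j) : l ∣ ∏ j ∈ s, a j - ∏ j ∈ s, b j := by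
  rw [← Ideal.mem_span_singleton, ← Ideal.Quotient.eq, map_prod, map_prod]
  refine Finset.prod_congr rfl fun j hj => ?_
  rw [Ideal.Quotient.eq, Ideal.mem_span_singleton]
  exact h j hj

end Fractions

/-! ### Linear forms as polynomials -/

section LinearForms

variable {r : ℕ}

/-- A linear functional, regarded as a homogeneous polynomial of degree one. -/
noncomputable def linPoly : ((Fin r → ℂ) →ₗ[ℂ] ℂ) →ₗ[ℂ] MvPolynomial (Fin r) ℂ where
  toFun φ := ∑ a, MvPolynomial.C (φ (Pi.single a 1)) * MvPolynomial.X a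
  map_add' φ ψ := by simp [add_mul, Finset.sum_add_distrib]
  map_smul' c φ := by simp [Finset.smul_sum, MvPolynomial.smul_eq_C_mul, mul_assoc]

@[simp]
theorem eval_linPoly (φ : (Fin r → ℂ) →ₗ[ℂ] ℂ) (x : Fin r → ℂ) :
    MvPolynomial.eval x (linPoly φ) = φ x := by
  have : x = ∑ a, x a • Pi.single (M := fun _ => ℂ) a 1 := by
    ext b
    simp [Finset.sum_apply, Pi.single_apply]
  conv_rhs => rw [this]
  simp [linPoly, mul_comm]

theorem irreducible_linPoly {φ : (Fin r → ℂ) →ₗ[ℂ] ℂ} (h : φ ≠ 0) : Irreducible (linPoly φ) := by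
  let c : Fin r →₀ ℂ := Finsupp.equivFunOnFinite.symm fun a => φ (Pi.single a 1)
  have hc : linPoly φ = MvPolynomial.sumSMulX c := by
    simp [linPoly, MvPolynomial.sumSMulX, c, Finsupp.linearCombination_apply,
      Finsupp.sum_fintype, MvPolynomial.smul_eq_C_mul]
  obtain ⟨a, ha⟩ : ∃ a, c a ≠ 0 := by
    by_contra! hcon
    apply h
    ext a
    simpa [c] using hcon a
  rw [hc]
  refine MvPolynomial.irreducible_sumSMulX c ⟨a, by simpa using ha⟩ fun t ht => ?_
  exact isUnit_of_dvd_unit (ht a) ha.isUnit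

/-- A prime dividing two linear forms forces each of them to vanish on the kernel of the other. -/
theorem apply_eq_zero_of_prime_dvd {p : MvPolynomial (Fin r) ℂ} (hp : Prime p)
    {φ ψ : (Fin r → ℂ) →ₗ[ℂ] ℂ} (hψ : ψ ≠ 0) (h1 : p ∣ linPoly φ) (h2 : p ∣ linPoly ψ)
    {x : Fin r → ℂ} (hx : ψ x = 0) : φ x = 0 := by
  have hdvd : linPoly ψ ∣ linPoly φ :=
    (((irreducible_linPoly hψ).dvd_iff.mp h2).resolve_left hp.not_isUnit).dvd.trans h1
  have := map_dvd (MvPolynomial.eval x) hdvd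
  rw [eval_linPoly, eval_linPoly, hx, zero_dvd_iff] at this
  exact this

end LinearForms

/-! ### Complexified dual families -/

/-- The inclusion of `ℝ ^ r` in `ℂ ^ r`. -/
def complexify {r : ℕ} : (Fin r → ℝ) →ₗ[ℝ] (Fin r → ℂ) where
  toFun x k := ((x k : ℝ) : ℂ)
  map_add' x y := by ext; simp
  map_smul' c x := by ext; simp

namespace IsDualFamily

variable {n r : ℕ} {v : Fin n → (Fin r → ℝ)} {J K : Finset (Fin n)}
  {ρ : Fin n → ((Fin r → ℝ) →ₗ[ℝ] ℝ)} {μ ν : Fin n → ((Fin r → ℂ) →ₗ[ℂ] ℂ)}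

theorem apply_complexify_eq (h : IsDualFamily v J ρ) (φ : (Fin r → ℂ) →ₗ[ℂ] ℂ)
    (x : Fin r → ℝ) : φ (complexify x) = ∑ j ∈ J, (ρ j x : ℂ) * φ (complexify (v j)) := by
  conv_lhs => rw [← h.sum_smul x, map_sum, map_sum]
  refine Finset.sum_congr rfl fun j _ => ?_
  rw [← smul_eq_mul, ← map_smul]
  congr 1
  ext m
  simp [complexify]

theorem complex_ext (h : IsDualFamily v J ρ) {φ ψ : (Fin r → ℂ) →ₗ[ℂ] ℂ}
    (hφ : ∀ j ∈ J, φ (complexify (v j)) = ψ (complexify (v j))) : φ = ψ := by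
  ext a
  have : Pi.single a (1 : ℂ) = complexify (Pi.single (M := fun _ => ℝ) a 1) := by
    ext b
    by_cases hb : b = a
    · subst hb
      simp [complexify]
    · simp [complexify, hb]
  simp only [LinearMap.coe_comp, LinearMap.coe_single, Function.comp_apply]
  rw [this, h.apply_complexify_eq, h.apply_complexify_eq]
  exact Finset.sum_congr rfl fun j hj => by rw [hφ j hj]

theorem complex_apply_eq (h : IsDualFamily v J ρ)
    (hμ : ∀ i ∈ J, ∀ j ∈ J, μ i (complexify (v j)) = if i = j then 1 else 0)
    {i : Fin n} (hi : i ∈ J) (x : Fin r → ℝ) :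
    μ i (complexify x) = (ρ i x : ℂ) := by
  rw [h.apply_complexify_eq, Finset.sum_congr rfl fun j hj => by rw [hμ i hi j hj]]
  simp [hi]

theorem complex_ne_zero (hμ : ∀ i ∈ J, ∀ j ∈ J, μ i (complexify (v j)) = if i = j then 1 else 0)
    {i : Fin n} (hi : i ∈ J) : μ i ≠ 0 := by
  intro h0
  have := hμ i hi i hi
  simp [h0] at this

/-- A prime divides at most one member of a dual family. -/
theorem eq_of_prime_dvd (hμ : ∀ i ∈ J, ∀ j ∈ J, μ i (complexify (v j)) = if i = j then 1 else 0)
    {p : MvPolynomial (Fin r) ℂ} (hp : Prime p) {i j : Fin n} (hi : i ∈ J)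
    (hj : j ∈ J) (h1 : p ∣ linPoly (μ i)) (h2 : p ∣ linPoly (μ j)) : i = j := by
  by_contra hij
  have := apply_eq_zero_of_prime_dvd hp (complex_ne_zero hμ hj) h1 h2
    (x := complexify (v i)) (by rw [hμ j hj i hi, if_neg (Ne.symm hij)])
  rw [hμ i hi i hi, if_pos rfl] at this
  exact one_ne_zero this

/-- The equations of a common facet of two maximal cones are proportional. -/
theorem complex_eq_smul (h : IsDualFamily v J ρ)
    (hμ : ∀ i ∈ J, ∀ j ∈ J, μ i (complexify (v j)) = if i = j then 1 else 0)
    {σ : Fin n → ((Fin r → ℝ) →ₗ[ℝ] ℝ)} (h' : IsDualFamily v K σ)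
    (hν : ∀ i ∈ K, ∀ j ∈ K, ν i (complexify (v j)) = if i = j then 1 else 0)
    {W : Finset (Fin n)} {i k : Fin n} (hi : i ∉ W) (hiJ : insert i W = J)
    (hkK : insert k W = K) : μ i = (ρ i (v k) : ℂ) • ν k := by
  have hiJ' : i ∈ J := hiJ ▸ Finset.mem_insert_self _ _
  have hkK' : k ∈ K := hkK ▸ Finset.mem_insert_self _ _
  refine h'.complex_ext fun j hj => ?_
  rw [LinearMap.smul_apply, hν k hkK' j hj]
  split_ifs with hkj
  · subst hkj
    rw [h.complex_apply_eq hμ hiJ']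
    simp
  · have hjW : j ∈ W := by
      rw [← hkK, Finset.mem_insert] at hj
      exact hj.resolve_left (Ne.symm hkj)
    rw [hμ i hiJ' j (hiJ ▸ Finset.mem_insert_of_mem hjW),
      if_neg (by rintro rfl; exact hi hjW), smul_zero]

/-- A polynomial that vanishes on a facet is divisible by the equation of that facet. -/
theorem linPoly_dvd_of_forall_eval_eq_zero (h : IsDualFamily v J ρ)
    (hμ : ∀ i ∈ J, ∀ j ∈ J, μ i (complexify (v j)) = if i = j then 1 else 0)
    {W : Finset (Fin n)} {i : Fin n} (hi : i ∉ W)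
    (hiJ : insert i W = J) {g : MvPolynomial (Fin r) ℂ}
    (hg : ∀ x ∈ coneOf v W, MvPolynomial.eval (complexify x) g = 0) : linPoly (μ i) ∣ g := by
  classical
  have hX : ∀ a, MvPolynomial.X a = ∑ j ∈ J, linPoly (μ j) * MvPolynomial.C (v j a : ℂ) := by
    intro a
    have hφ : LinearMap.proj a = ∑ j ∈ J, (v j a : ℂ) • μ j := by
      refine h.complex_ext fun l hl => ?_
      rw [LinearMap.sum_apply,
        Finset.sum_congr rfl fun j hj => by rw [LinearMap.smul_apply, hμ j hj l hl]]
      simp [hl, complexify]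
    refine MvPolynomial.funext fun x => ?_
    have := congrArg (fun φ : (Fin r → ℂ) →ₗ[ℂ] ℂ => φ x) hφ
    simpa [map_sum, mul_comm] using this
  let y : Fin r → MvPolynomial W ℂ := fun a => ∑ j : W, MvPolynomial.X j *
    MvPolynomial.C (v j a : ℂ)
  have hzero : MvPolynomial.aeval y g = 0 := by
    refine MvPolynomial.funext_set (fun _ => Complex.ofReal '' Set.Ici 0)
      (fun _ => (Set.Ici_infinite 0).image Complex.ofReal_injective.injOn) fun c hc => ?_
    have hc' : ∀ j : W, ∃ t : ℝ, 0 ≤ t ∧ (t : ℂ) = c j := fun j => by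
      obtain ⟨t, ht, htc⟩ := hc j (Set.mem_univ _)
      exact ⟨t, ht, htc⟩
    choose t ht htc using hc'
    let t' : Fin n → ℝ := fun j => if hj : j ∈ W then t ⟨j, hj⟩ else 0
    have hmem : ∑ j ∈ W, t' j • v j ∈ coneOf v W :=
      sum_smul_mem_coneOf v fun j hj => by simp [t', hj, ht]
    rw [map_zero, ← hg _ hmem, ← MvPolynomial.coe_aeval_eq_eval, ← MvPolynomial.coe_aeval_eq_eval]
    change MvPolynomial.aeval c (MvPolynomial.aeval y g) = MvPolynomial.aeval _ g
    rw [← AlgHom.comp_apply, MvPolynomial.comp_aeval]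
    congr 2
    ext a
    simp only [y, map_sum, map_mul, MvPolynomial.aeval_X, MvPolynomial.aeval_C]
    rw [← Finset.sum_coe_sort W]
    simp [complexify, t', htc, Finset.sum_apply]
  rw [← Ideal.mem_span_singleton, ← Ideal.Quotient.eq_zero_iff_mem]
  set q := Ideal.Quotient.mkₐ ℂ (Ideal.span {linPoly (μ i)}) with hq
  change q g = 0
  have hcomp : q g = MvPolynomial.aeval (fun j : W => q (linPoly (μ j)))
      (MvPolynomial.aeval y g) := by
    rw [← AlgHom.comp_apply, MvPolynomial.comp_aeval]
    conv_lhs => rw [← MvPolynomial.aeval_X_left_apply g, ← AlgHom.comp_apply,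
      MvPolynomial.comp_aeval]
    congr 2
    ext a
    have hqi : q (linPoly (μ i)) = 0 :=
      Ideal.Quotient.eq_zero_iff_mem.mpr (Ideal.mem_span_singleton_self _)
    rw [hX a, ← hiJ, Finset.sum_insert hi, map_add, map_mul, hqi, zero_mul, zero_add,
      ← Finset.sum_coe_sort W]
    simp only [y, map_sum, map_mul, MvPolynomial.aeval_X]
    simp only [← MvPolynomial.algebraMap_eq, AlgHom.commutes]
  rw [hcomp, hzero, map_zero]

/-- The poles of the terms of two adjacent maximal cones along their common facet cancel. -/
theorem add_mem_regularAt (h : IsDualFamily v J ρ)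
    (hμ : ∀ i ∈ J, ∀ j ∈ J, μ i (complexify (v j)) = if i = j then 1 else 0)
    {F : Type*} [Field F] [Algebra (MvPolynomial (Fin r) ℂ) F]
    [IsFractionRing (MvPolynomial (Fin r) ℂ) F]
    {σ : Fin n → ((Fin r → ℝ) →ₗ[ℝ] ℝ)} (h' : IsDualFamily v K σ)
    (hν : ∀ i ∈ K, ∀ j ∈ K, ν i (complexify (v j)) = if i = j then 1 else 0)
    {W : Finset (Fin n)} {i k : Fin n} (hi : i ∉ W) (hiJ : insert i W = J) (hk : k ∉ W)
    (hkK : insert k W = K) {p : MvPolynomial (Fin r) ℂ} (hp : Prime p) (hpi : p ∣ linPoly (μ i))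
    (hpk : p ∣ linPoly (ν k)) {f g : MvPolynomial (Fin r) ℂ}
    (hfg : ∀ x ∈ coneOf v W,
      MvPolynomial.eval (complexify x) f = MvPolynomial.eval (complexify x) g)
    {a b : ℝ} (hab : b = -ρ i (v k) * a) :
    algebraMap _ F (MvPolynomial.C (a : ℂ)⁻¹ * f) / algebraMap _ F (∏ j ∈ J, linPoly (μ j)) +
      algebraMap _ F (MvPolynomial.C (b : ℂ)⁻¹ * g) / algebraMap _ F (∏ j ∈ K, linPoly (ν j)) ∈
        regularAt F hp := by
  classical
  have hiJ' : i ∈ J := hiJ ▸ Finset.mem_insert_self _ _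
  have hkK' : k ∈ K := hkK ▸ Finset.mem_insert_self _ _
  have hWJ : W ⊆ J := hiJ ▸ Finset.subset_insert _ _
  have hWK : W ⊆ K := hkK ▸ Finset.subset_insert _ _
  have hsmul := h.complex_eq_smul hμ h' hν hi hiJ hkK
  have hbk : MvPolynomial.C (b : ℂ) * linPoly (ν k) = -(MvPolynomial.C (a : ℂ) * linPoly (μ i)) := by
    rw [hsmul, map_smul, MvPolynomial.smul_eq_C_mul, hab]
    push_cast
    simp only [map_neg, map_mul]
    ring
  have hdiff : ∀ j ∈ W, linPoly (μ i) ∣ linPoly (μ j) - linPoly (ν j) := by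
    intro j hj
    have : μ j - ν j = (-(ν j (complexify (v i)))) • μ i := by
      refine h.complex_ext fun l hl => ?_
      simp only [LinearMap.sub_apply, LinearMap.smul_apply, hμ j (hWJ hj) l hl, hμ i hiJ' l hl]
      rw [← hiJ, Finset.mem_insert] at hl
      rcases hl with rfl | hl
      · rw [if_neg (by rintro rfl; exact hi hj)]
        simp
      · rw [hν j (hWK hj) l (hWK hl), if_neg (show i ≠ l by rintro rfl; exact hi hl)]
        simp
    rw [← map_sub, this, map_smul, MvPolynomial.smul_eq_C_mul]
    exact dvd_mul_left _ _
  set A := ∏ j ∈ W, linPoly (μ j) with hA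
  set B := ∏ j ∈ W, linPoly (ν j) with hB
  have hpA : ¬ p ∣ A := fun hd => by
    obtain ⟨j, hj, hpj⟩ := hp.exists_mem_finset_dvd hd
    exact hi (eq_of_prime_dvd hμ hp hiJ' (hWJ hj) hpi hpj ▸ hj)
  have hpB : ¬ p ∣ B := fun hd => by
    obtain ⟨j, hj, hpj⟩ := hp.exists_mem_finset_dvd hd
    exact hk (eq_of_prime_dvd hν hp hkK' (hWK hj) hpk hpj ▸ hj)
  have hfg' : linPoly (μ i) ∣ f - g :=
    h.linPoly_dvd_of_forall_eval_eq_zero hμ hi hiJ fun x hx => by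
      rw [map_sub, hfg x hx, sub_self]
  obtain ⟨q, hq⟩ : linPoly (μ i) ∣ f * B - g * A := by
    have : f * B - g * A = (f - g) * B - g * (A - B) := by ring
    rw [this]
    exact dvd_sub (dvd_mul_of_dvd_left hfg' _)
      (dvd_mul_of_dvd_right (prod_sub_prod_dvd _ _ _ _ hdiff) _)
  have hne : ∀ c : MvPolynomial (Fin r) ℂ, c ≠ 0 → algebraMap _ F c ≠ 0 := fun c hc => by
    rwa [Ne, IsFractionRing.to_map_eq_zero_iff]
  have hA0 := hne A (by rintro h0; exact hpA (h0 ▸ dvd_zero p))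
  have hB0 := hne B (by rintro h0; exact hpB (h0 ▸ dvd_zero p))
  have hx0 := hne _ (irreducible_linPoly (complex_ne_zero hμ hiJ')).ne_zero
  have hC : ∀ c : ℂ, algebraMap _ F (MvPolynomial.C (σ := Fin r) c⁻¹) =
      (algebraMap _ F (MvPolynomial.C (σ := Fin r) c))⁻¹ := fun c =>
    map_inv₀ ((algebraMap (MvPolynomial (Fin r) ℂ) F).comp MvPolynomial.C) c
  have hbk' := congrArg (fun z => (algebraMap _ F z)⁻¹) hbk
  have hq' := congrArg (algebraMap _ F) hq
  simp only [map_mul, map_neg, map_sub, mul_inv, inv_neg] at hbk' hq'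
  convert! div_mem_regularAt (K := F) hp (MvPolynomial.C (a : ℂ)⁻¹ * q)
    (hp.not_dvd_mul hpA hpB) using 1
  rw [← hiJ, ← hkK, Finset.prod_insert hi, Finset.prod_insert hk, ← hA, ← hB]
  simp only [map_mul, hC]
  have e1 : ∀ s t x A : F, s * t / (x * A) = (s * x⁻¹) * (t / A) := fun s t x A => by
    rw [div_eq_mul_inv, div_eq_mul_inv, mul_inv]
    ring
  rw [e1, e1, hbk', neg_mul, ← sub_eq_add_neg, ← mul_sub, div_sub_div _ _ hA0 hB0,
    mul_comm (algebraMap _ F A) (algebraMap _ F g), hq']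
  field_simp

end IsDualFamily

/-- The covolumes of two adjacent maximal cones. -/
theorem covolume_eq_abs_mul {n r : ℕ} {v : Fin n → (Fin r → ℝ)} {J K : Finset (Fin n)}
    {ρ : Fin n → ((Fin r → ℝ) →ₗ[ℝ] ℝ)} (h : IsDualFamily v J ρ) (hJr : J.card = r)
    {a b : ℝ}
    (ha : ∀ e : Fin r → Fin n, Function.Injective e →
      (∀ l, e l ∈ J) → a = |Matrix.det (Matrix.of fun m l => v (e l) m)|)
    (hb : ∀ e : Fin r → Fin n, Function.Injective e →
      (∀ l, e l ∈ K) → b = |Matrix.det (Matrix.of fun m l => v (e l) m)|)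
    {W : Finset (Fin n)} {i k : Fin n} (hiJ : insert i W = J) (hk : k ∉ W)
    (hkK : insert k W = K) : b = |ρ i (v k)| * a := by
  classical
  let ε : Fin r ≃ J := (J.equivFinOfCardEq hJr).symm
  have hiJ' : i ∈ J := hiJ ▸ Finset.mem_insert_self _ _
  set e : Fin r → Fin n := fun l => ε l
  have he : Function.Injective e := Subtype.val_injective.comp ε.injective
  set l₀ := ε.symm ⟨i, hiJ'⟩ with hl₀
  have hel₀ : e l₀ = i := by simp [e, hl₀]
  have heW : ∀ l, l ≠ l₀ → e l ∈ W := fun l hl => by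
    have h1 : e l ∈ J := (ε l).2
    rw [← hiJ, Finset.mem_insert] at h1
    exact h1.resolve_left fun h2 => hl (he (h2.trans hel₀.symm))
  rw [ha e he fun l => (ε l).2, hb (Function.update e l₀ k), ← abs_mul]
  · have hcol : (Matrix.of fun m l => v (Function.update e l₀ k l) m) =
        (Matrix.of fun m l => v (e l) m).updateCol l₀
          (fun m => ∑ l, ρ (e l) (v k) • (Matrix.of fun m l => v (e l) m) m l) := by
      ext m l
      rw [Matrix.updateCol_apply]
      split_ifs with hl
      · subst hl
        have := congrFun (h.sum_smul (v k)) m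
        rw [← Finset.sum_coe_sort, ← ε.sum_comp] at this
        simpa [Finset.sum_apply] using this.symm
      · simp [hl]
    rw [hcol, Matrix.det_updateCol_sum, hel₀, smul_eq_mul]
  · intro l m hlm
    by_cases h1 : l = l₀ <;> by_cases h2 : m = l₀
    · rw [h1, h2]
    · subst h1
      rw [Function.update_self, Function.update_of_ne h2] at hlm
      exact absurd (hlm ▸ heW m h2) hk
    · subst h2
      rw [Function.update_self, Function.update_of_ne h1] at hlm
      exact absurd (hlm ▸ heW l h1) hk
    · rw [Function.update_of_ne h1, Function.update_of_ne h2] at hlm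
      exact he hlm
  · intro l
    rw [← hkK]
    by_cases h1 : l = l₀
    · subst h1
      simp
    · rw [Function.update_of_ne h1]
      exact Finset.mem_insert_of_mem (heW l h1)

/-- let `Σ` be a complete simplicial fan in `N_ℝ ≅ ℝ^r` with maximal cones
`J` (of `r` rays, with ray generators among `v₁,…,v_n`), let `u_{i,J}` be the linear
function equal to `1` at `v_i` and `0` at the other `v_j`, `j ∈ J`, and let `Vol(J)` be
the covolume (absolute determinant) of the generators of `J`. For any continuous
`Σ`-piecewise polynomial function `f = (f_J)`, the rational function
`∑_{|J|=r} (1/|Vol(J)|)·f_J·∏_{i∈J} 1/u_{i,J}` on `N_ℂ` is in fact a polynomial: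
there is a polynomial `P` agreeing with it wherever all `u_{i,J}` are nonzero. -/
theorem stmt3 {n r : ℕ} (v : Fin n → (Fin r → ℝ)) (S : Finset (Finset (Fin n)))
    (hdc : ∀ I ∈ S, ∀ J ⊆ I, J ∈ S)
    (hind : ∀ I ∈ S, LinearIndependent ℝ (fun i : I => v i))
    (hglue : ∀ I ∈ S, ∀ J ∈ S, coneOf v I ∩ coneOf v J = coneOf v (I ∩ J))
    -- the fan is complete
    (hcomplete : (⋃ I ∈ S, coneOf v I) = Set.univ)
    -- every cone of `S` is contained in a maximal (r-dimensional) one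
    (hmax : ∀ I ∈ S, ∃ J ∈ S, I ⊆ J ∧ J.card = r)
    -- the dual basis linear functions `u_{i,J}`
    (u : Fin n → Finset (Fin n) → ((Fin r → ℂ) →ₗ[ℂ] ℂ))
    (hu : ∀ J ∈ S, J.card = r → ∀ i ∈ J, ∀ j ∈ J,
      u i J (fun k => ((v j k : ℝ) : ℂ)) = if i = j then 1 else 0)
    -- the covolumes `|Vol(J)|`
    (Vol : Finset (Fin n) → ℝ)
    (hVol : ∀ J ∈ S, J.card = r → ∀ e : Fin r → Fin n, Function.Injective e →
      (∀ a, e a ∈ J) → Vol J = |Matrix.det (Matrix.of fun a b => v (e b) a)|)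
    -- the piecewise polynomial function `f = (f_J)`: compatible on overlaps
    (f : Finset (Fin n) → MvPolynomial (Fin r) ℂ)
    (hf : ∀ J ∈ S, ∀ K ∈ S, J.card = r → K.card = r →
      ∀ x ∈ coneOf v J ∩ coneOf v K,
        MvPolynomial.eval (fun k => ((x k : ℝ) : ℂ)) (f J) =
        MvPolynomial.eval (fun k => ((x k : ℝ) : ℂ)) (f K)) :
    ∃ P : MvPolynomial (Fin r) ℂ,
      ∀ x : Fin r → ℂ,
        (∀ J ∈ S.filter (fun J => J.card = r), ∀ i ∈ J, u i J x ≠ 0) →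
        ∑ J ∈ S.filter (fun J => J.card = r),
          ((Vol J : ℂ))⁻¹ * MvPolynomial.eval x (f J) * ∏ i ∈ J, (u i J x)⁻¹ =
          MvPolynomial.eval x P := by
  classical
  replace hu : ∀ J ∈ S, J.card = r → ∀ i ∈ J, ∀ j ∈ J,
    u i J (complexify (v j)) = if i = j then 1 else 0 := hu
  have hex : ∀ J : Finset (Fin n), ∃ ρ, J ∈ S → J.card = r → IsDualFamily v J ρ := by
    intro J
    by_cases hJ : J ∈ S ∧ J.card = r
    · obtain ⟨ρ, hρ⟩ := exists_isDualFamily (hind J hJ.1) hJ.2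
      exact ⟨ρ, fun _ _ => hρ⟩
    · exact ⟨0, fun h1 h2 => absurd ⟨h1, h2⟩ hJ⟩
  choose ρ hρ using hex
  let F := FractionRing (MvPolynomial (Fin r) ℂ)
  set M := S.filter (fun J => J.card = r) with hM
  have hmemM : ∀ {J}, J ∈ M → J ∈ S ∧ J.card = r := fun h => Finset.mem_filter.mp h
  let N : Finset (Fin n) → MvPolynomial (Fin r) ℂ := fun J =>
    MvPolynomial.C ((Vol J : ℂ))⁻¹ * f J
  let D : Finset (Fin n) → MvPolynomial (Fin r) ℂ := fun J => ∏ i ∈ J, linPoly (u i J)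
  have hreg : ∀ p : MvPolynomial (Fin r) ℂ, ∀ hp : Prime p,
      ∑ J ∈ M, algebraMap _ F (N J) / algebraMap _ F (D J) ∈ regularAt F hp := by
    intro p hp
    let G : Finset (Fin n) → Finset (Fin n) := fun J => J.filter (fun i => ¬ p ∣ linPoly (u i J))
    have hG : ∀ {J : Finset (Fin n)}, J ∈ M → ∀ {i}, i ∈ J → p ∣ linPoly (u i J) →
        G J = J.erase i := by
      intro J hJ i hi hpi
      obtain ⟨hJS, hJr⟩ := hmemM hJ
      ext j
      simp only [G, Finset.mem_filter, Finset.mem_erase]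
      constructor
      · rintro ⟨hj, hpj⟩
        exact ⟨by rintro rfl; exact hpj hpi, hj⟩
      · rintro ⟨hji, hj⟩
        exact ⟨hj, fun hpj => hji (IsDualFamily.eq_of_prime_dvd (μ := fun i => u i J)
          (hu J hJS hJr) hp hj hi hpj hpi)⟩
    rw [← Finset.sum_fiberwise_of_maps_to (g := G) (t := M.image G)
      fun J hJ => Finset.mem_image_of_mem G hJ]
    refine sum_mem fun W hW => ?_
    obtain ⟨J, hJ, rfl⟩ := Finset.mem_image.mp hW
    obtain ⟨hJS, hJr⟩ := hmemM hJ
    have hdJ := hρ J hJS hJr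
    by_cases hpole : ∃ i ∈ J, p ∣ linPoly (u i J)
    · obtain ⟨i, hi, hpi⟩ := hpole
      obtain ⟨K, hKS, hKr, k, hk, hkK, hneg⟩ := exists_adjacent hglue hcomplete hmax hρ hJS hJr hi
      have hdK := hρ K hKS hKr
      have hKM : K ∈ M := Finset.mem_filter.mpr ⟨hKS, hKr⟩
      have hkK' : k ∈ K := hkK ▸ Finset.mem_insert_self _ _
      have hiW : i ∉ J.erase i := Finset.notMem_erase _ _
      have hiJ : insert i (J.erase i) = J := Finset.insert_erase hi
      have hsmul := hdJ.complex_eq_smul (μ := fun i => u i J) (ν := fun i => u i K)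
        (hu J hJS hJr) hdK (hu K hKS hKr) hiW hiJ hkK
      have hpk : p ∣ linPoly (u k K) := by
        have : u k K = ((ρ J i (v k) : ℂ))⁻¹ • u i J := by
          have hne : (ρ J i (v k) : ℂ) ≠ 0 := by exact_mod_cast hneg.ne
          rw [eq_inv_smul_iff₀ hne]
          exact hsmul.symm
        rw [this, map_smul, MvPolynomial.smul_eq_C_mul]
        exact dvd_mul_of_dvd_right hpi _
      have hGJ := hG hJ hi hpi
      have hGK : G K = J.erase i := by
        rw [hG hKM hkK' hpk, ← hkK, Finset.erase_insert hk]
      have hJK : J ≠ K := by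
        rintro rfl
        rw [hdJ.apply_eq i hi k hkK'] at hneg
        split_ifs at hneg <;> linarith
      have hfib : M.filter (fun L => G L = G J) = {J, K} := by
        ext L
        simp only [Finset.mem_filter, Finset.mem_insert, Finset.mem_singleton]
        constructor
        · rintro ⟨hL, hGL⟩
          obtain ⟨hLS, hLr⟩ := hmemM hL
          have hdL := hρ L hLS hLr
          obtain ⟨l, hl, hpl⟩ : ∃ l ∈ L, p ∣ linPoly (u l L) := by
            by_contra! hcon
            have h1 : G L = L := Finset.filter_true_of_mem hcon
            have h2 := Finset.card_erase_add_one hi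
            rw [← hGJ, ← hGL, h1, hJr, hLr] at h2
            omega
          have hlW : L.erase l = J.erase i := by rw [← hG hL hl hpl, hGL, hGJ]
          have hlL : insert l (J.erase i) = L := by rw [← hlW, Finset.insert_erase hl]
          have hsmul' := hdJ.complex_eq_smul (μ := fun i => u i J) (ν := fun i => u i L)
            (hu J hJS hJr) hdL (hu L hLS hLr) hiW hiJ hlL
          have hne : ρ J i (v l) ≠ 0 := by
            intro h0
            rw [h0, Complex.ofReal_zero, zero_smul] at hsmul'
            exact IsDualFamily.complex_ne_zero (μ := fun i => u i J) (hu J hJS hJr) hi hsmul'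
          rcases hne.lt_or_gt with hlt | hgt
          · right
            have hmul : ρ J i (v l) = ρ J i (v k) * ρ K k (v l) := by
              have := congrArg (fun φ : (Fin r → ℂ) →ₗ[ℂ] ℂ => φ (complexify (v l))) hsmul
              simp only [LinearMap.smul_apply, smul_eq_mul] at this
              rw [hdJ.complex_apply_eq (μ := fun i => u i J) (hu J hJS hJr) hi,
                hdK.complex_apply_eq (μ := fun i => u i K) (hu K hKS hKr) hkK'] at this
              exact_mod_cast this
            refine (eq_of_pos_apply hglue hρ hKS hKr hLS hLr hk hkK hlL ?_).symm
            rw [hmul] at hlt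
            exact pos_of_mul_neg_right hlt hneg.le
          · left
            exact (eq_of_pos_apply hglue hρ hJS hJr hLS hLr hiW hiJ hlL hgt).symm
        · rintro (rfl | rfl)
          · exact ⟨hJ, rfl⟩
          · exact ⟨hKM, hGK.trans hGJ.symm⟩
      rw [hfib, Finset.sum_pair hJK]
      refine hdJ.add_mem_regularAt (μ := fun i => u i J) (ν := fun i => u i K)
        (hu J hJS hJr) hdK (hu K hKS hKr) hiW hiJ hk hkK hp hpi hpk ?_ ?_
      · intro x hx
        exact hf J hJS K hKS hJr hKr x ⟨coneOf_mono v (Finset.erase_subset _ _) hx,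
          coneOf_mono v (hkK ▸ Finset.subset_insert _ _) hx⟩
      · rw [covolume_eq_abs_mul hdJ hJr (hVol J hJS hJr) (hVol K hKS hKr) hiJ hk hkK,
          abs_of_neg hneg]
    · push Not at hpole
      have hGJ : G J = J := Finset.filter_true_of_mem hpole
      refine sum_mem fun L hL => ?_
      obtain ⟨hLM, hGL⟩ := Finset.mem_filter.mp hL
      have hLJ : J = L := Finset.eq_of_subset_of_card_le
        (hGJ ▸ hGL ▸ Finset.filter_subset _ _) (by rw [hJr, (hmemM hLM).2])
      subst hLJ
      refine div_mem_regularAt hp _ fun hd => ?_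
      obtain ⟨i, hi, hpi⟩ := hp.exists_mem_finset_dvd hd
      exact hpole i hi hpi
  obtain ⟨P, hP⟩ := exists_algebraMap_eq_of_forall_mem_regularAt hreg
  refine ⟨P, fun x hx => ?_⟩
  rw [← sum_div_eq_of_sum_div_eq_algebraMap (MvPolynomial.eval x) M N D P ?_ hP.symm]
  · refine Finset.sum_congr rfl fun J _ => ?_
    simp [N, D, div_eq_mul_inv, map_prod, Finset.prod_inv_distrib]
  · intro J hJ
    simp only [D, map_prod, eval_linPoly]
    exact Finset.prod_ne_zero_iff.mpr (hx J hJ)
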